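/- In the ring H_res = ℂ[m1,m2]/⟨m2², m1⁴−2m1³m2⟩, the eight elements 1, m1, m1−2m2, m1², m1²−2m1m2, m1³, m1³−2m1²m2, m1⁴ form a ℂ-vector-space basis (so H_res has ℂ-dimension 8), and the relations 2m1³m2 = m1⁴ and m1⁵ = 0 hold. -/

import Mathlib

noncomputable section
open MvPolynomial

/-- The polynomial ring ℂ[m1,m2]. -/
abbrev Poly2 := MvPolynomial (Fin 2) ℂ

/-- The ideal ⟨m2², m1⁴−2m1³m2⟩. -/
def Ires : Ideal Poly2 :=
  Ideal.span {X 1 ^ 2, X 0 ^ 4 - 2 * (X 0 ^ 3 * X 1)}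

/-- H_res = ℂ[m1,m2]/⟨m2², m1⁴−2m1³m2⟩, the cohomology ring of the toric
resolution of the toric degeneration of Gr(2,4). -/
abbrev Hres := Poly2 ⧸ Ires

def m1 : Hres := Ideal.Quotient.mk Ires (X 0)
def m2 : Hres := Ideal.Quotient.mk Ires (X 1)

/-- The eight elements 1, m1, m1−2m2, m1², m1²−2m1m2, m1³, m1³−2m1²m2, m1⁴. -/
def basRes : Fin 8 → Hres :=
  ![1, m1, m1 - 2 * m2, m1 ^ 2, m1 ^ 2 - 2 * (m1 * m2), m1 ^ 3,
    m1 ^ 3 - 2 * (m1 ^ 2 * m2), m1 ^ 4]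

section

variable {A : Type*} [CommRing A] {a b : A}

theorem pow_four_mul_eq_zero (hb : b ^ 2 = 0) (hab : a ^ 4 = 2 * (a ^ 3 * b)) :
    a ^ 4 * b = 0 := by
  linear_combination b * hab + 2 * a ^ 3 * hb

theorem pow_five_eq_zero (hb : b ^ 2 = 0) (hab : a ^ 4 = 2 * (a ^ 3 * b)) :
    a ^ 5 = 0 := by
  linear_combination a * hab + 2 * pow_four_mul_eq_zero hb hab

variable [Algebra ℂ A]

theorem linearIndependent_of_pow_four_ne_zero (hb : b ^ 2 = 0)
    (hab : a ^ 4 = 2 * (a ^ 3 * b)) (ha : a ^ 4 ≠ 0) :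
    LinearIndependent ℂ
      ![1, a, a - 2 * b, a ^ 2, a ^ 2 - 2 * (a * b), a ^ 3, a ^ 3 - 2 * (a ^ 2 * b), a ^ 4] := by
  rw [Fintype.linearIndependent_iff]
  intro c hc
  have h4 := pow_four_mul_eq_zero hb hab
  have h5 := pow_five_eq_zero hb hab
  have cancel (z : ℂ) (hz : algebraMap ℂ A z * a ^ 4 = 0) : z = 0 := by
    rw [← Algebra.smul_def] at hz
    exact (smul_eq_zero.mp hz).resolve_right ha
  simp only [Fin.sum_univ_eight, Algebra.smul_def] at hc
  simp at hc
  have h0 : c 0 = 0 := by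
    apply cancel
    linear_combination a ^ 4 * hc + 2 * algebraMap ℂ A (c 2) * h4 -
      (algebraMap ℂ A (c 1) + algebraMap ℂ A (c 2) +
        (algebraMap ℂ A (c 3) + algebraMap ℂ A (c 4)) * a - 2 * algebraMap ℂ A (c 4) * b +
        (algebraMap ℂ A (c 5) + algebraMap ℂ A (c 6)) * a ^ 2 -
        2 * algebraMap ℂ A (c 6) * a * b + algebraMap ℂ A (c 7) * a ^ 3) * h5
  simp only [h0, map_zero, zero_add] at hc
  have h1 : c 1 = 0 := by
    apply cancel
    linear_combination a ^ 3 * hc - algebraMap ℂ A (c 2) * hab + 2 * algebraMap ℂ A (c 4) * h4 -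
      (algebraMap ℂ A (c 3) + algebraMap ℂ A (c 4) +
        (algebraMap ℂ A (c 5) + algebraMap ℂ A (c 6)) * a - 2 * algebraMap ℂ A (c 6) * b +
        algebraMap ℂ A (c 7) * a ^ 2) * h5
  simp only [h1, map_zero, zero_mul, zero_add] at hc
  have h2 : c 2 = 0 := by
    apply cancel
    linear_combination 2 * a ^ 2 * b * hc + algebraMap ℂ A (c 2) * hab +
      4 * (algebraMap ℂ A (c 2) * a ^ 2 + algebraMap ℂ A (c 4) * a ^ 3 +
        algebraMap ℂ A (c 6) * a ^ 4) * hb -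
      2 * (algebraMap ℂ A (c 3) + algebraMap ℂ A (c 4) +
        (algebraMap ℂ A (c 5) + algebraMap ℂ A (c 6)) * a + algebraMap ℂ A (c 7) * a ^ 2) * h4
  simp only [h2, map_zero, zero_mul, zero_add] at hc
  have h3 : c 3 = 0 := by
    apply cancel
    linear_combination a ^ 2 * hc - algebraMap ℂ A (c 4) * hab + 2 * algebraMap ℂ A (c 6) * h4 -
      (algebraMap ℂ A (c 5) + algebraMap ℂ A (c 6) + algebraMap ℂ A (c 7) * a) * h5
  simp only [h3, map_zero, zero_mul, zero_add] at hc
  have h4' : c 4 = 0 := by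
    apply cancel
    linear_combination 2 * a * b * hc + algebraMap ℂ A (c 4) * hab +
      4 * (algebraMap ℂ A (c 4) * a ^ 2 + algebraMap ℂ A (c 6) * a ^ 3) * hb -
      2 * (algebraMap ℂ A (c 5) + algebraMap ℂ A (c 6) + algebraMap ℂ A (c 7) * a) * h4
  simp only [h4', map_zero, zero_mul, zero_add] at hc
  have h5' : c 5 = 0 := by
    apply cancel
    linear_combination a * hc - algebraMap ℂ A (c 6) * hab - algebraMap ℂ A (c 7) * h5
  simp only [h5', map_zero, zero_mul, zero_add] at hc
  have h6 : c 6 = 0 := by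
    apply cancel
    linear_combination 2 * b * hc + algebraMap ℂ A (c 6) * hab +
      4 * algebraMap ℂ A (c 6) * a ^ 2 * hb - 2 * algebraMap ℂ A (c 7) * h4
  simp only [h6, map_zero, zero_mul, zero_add] at hc
  have h7 : c 7 = 0 := cancel _ hc
  intro i
  fin_cases i <;> assumption

theorem mul_mem_span_of_relations (hb : b ^ 2 = 0) (hab : a ^ 4 = 2 * (a ^ 3 * b)) {x : A}
    (hx : x ∈ Submodule.span ℂ (Set.range
      ![1, a, a - 2 * b, a ^ 2, a ^ 2 - 2 * (a * b), a ^ 3, a ^ 3 - 2 * (a ^ 2 * b), a ^ 4])) :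
    x * a ∈ Submodule.span ℂ (Set.range
      ![1, a, a - 2 * b, a ^ 2, a ^ 2 - 2 * (a * b), a ^ 3, a ^ 3 - 2 * (a ^ 2 * b), a ^ 4]) ∧
    x * b ∈ Submodule.span ℂ (Set.range
      ![1, a, a - 2 * b, a ^ 2, a ^ 2 - 2 * (a * b), a ^ 3, a ^ 3 - 2 * (a ^ 2 * b), a ^ 4]) := by
  set v : Fin 8 → A :=
    ![1, a, a - 2 * b, a ^ 2, a ^ 2 - 2 * (a * b), a ^ 3, a ^ 3 - 2 * (a ^ 2 * b), a ^ 4] with hv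
  set S := Submodule.span ℂ (Set.range v)
  have hS (i : Fin 8) : v i ∈ S := Submodule.subset_span ⟨i, rfl⟩
  have half {y z : A} (hz : z ∈ S) (hyz : z = 2 * y) : y ∈ S := by
    have : y = (2⁻¹ : ℂ) • z := by
      rw [hyz, two_mul, ← two_smul ℂ y, smul_smul]
      norm_num
    exact this ▸ S.smul_mem _ hz
  have eq_zero_mem {y : A} (hy : y = 0) : y ∈ S := hy ▸ S.zero_mem
  have h4 := pow_four_mul_eq_zero hb hab
  have h5 := pow_five_eq_zero hb hab
  have mem_b : b ∈ S := half (S.sub_mem (hS 1) (hS 2)) (by simp [hv])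
  have mem_ab : a * b ∈ S := half (S.sub_mem (hS 3) (hS 4)) (by simp [hv])
  have mem_a2b : a ^ 2 * b ∈ S := half (S.sub_mem (hS 5) (hS 6)) (by simp [hv])
  have mem_a3b : a ^ 3 * b ∈ S := half (hS 7) hab
  induction hx using Submodule.span_induction with
  | zero => simp
  | add x y _ _ hx hy =>
    simp only [add_mul]
    exact ⟨S.add_mem hx.1 hy.1, S.add_mem hx.2 hy.2⟩
  | smul c x _ hx =>
    simp only [smul_mul_assoc]
    exact ⟨S.smul_mem c hx.1, S.smul_mem c hx.2⟩
  | mem x hx =>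
    obtain ⟨i, rfl⟩ := hx
    fin_cases i
    · exact ⟨by convert hS 1 using 1; simp [hv], by convert mem_b using 1; simp [hv]⟩
    · exact ⟨by convert hS 3 using 1; simp [hv]; ring, mem_ab⟩
    · refine ⟨by convert hS 4 using 1; simp [hv]; ring, ?_⟩
      convert mem_ab using 1
      simp [hv]
      linear_combination -2 * hb
    · exact ⟨by convert hS 5 using 1; simp [hv]; ring, mem_a2b⟩
    · refine ⟨by convert hS 6 using 1; simp [hv]; ring, ?_⟩
      convert mem_a2b using 1
      simp [hv]
      linear_combination -2 * a * hb
    · exact ⟨by convert hS 7 using 1; simp [hv]; ring, mem_a3b⟩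
    · refine ⟨eq_zero_mem ?_, ?_⟩
      · simp [hv]
        linear_combination hab
      · convert mem_a3b using 1
        simp [hv]
        linear_combination -2 * a ^ 2 * hb
    · exact ⟨eq_zero_mem (by simp [hv]; linear_combination h5), eq_zero_mem h4⟩

end

theorem m2_sq : m2 ^ 2 = 0 := by
  rw [m2, ← map_pow, Ideal.Quotient.eq_zero_iff_mem]
  exact Ideal.subset_span (by simp)

theorem m1_pow_four : m1 ^ 4 = 2 * (m1 ^ 3 * m2) := by
  have h : Ideal.Quotient.mk Ires (X 0 ^ 4 - 2 * (X 0 ^ 3 * X 1)) = 0 :=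
    Ideal.Quotient.eq_zero_iff_mem.mpr (Ideal.subset_span (by simp))
  exact sub_eq_zero.mp h

theorem m1_pow_four_ne_zero : m1 ^ 4 ≠ 0 := by
  rw [m1, ← map_pow, Ne, Ideal.Quotient.eq_zero_iff_mem, Ires, Ideal.mem_span_pair]
  rintro ⟨p, q, h⟩
  have e0 : (X 0 ^ 4 : Poly2) = monomial (Finsupp.single 0 4) 1 := X_pow_eq_monomial
  have e1 : (X 1 ^ 2 : Poly2) = monomial (Finsupp.single 1 2) 1 := X_pow_eq_monomial
  have e2 : (2 * (X 0 ^ 3 * X 1) : Poly2) =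
      monomial (Finsupp.single 0 3 + Finsupp.single 1 1) 2 := by
    rw [X_pow_eq_monomial, X, monomial_mul, two_mul, ← map_add]
    norm_num
  rw [e0, e1, e2, mul_sub] at h
  have h40 := congrArg (coeff (Finsupp.single 0 4)) h
  have h31 := congrArg (coeff (Finsupp.single 0 3 + Finsupp.single 1 1)) h
  simp [coeff_mul_monomial', coeff_monomial, Finsupp.le_def, Finsupp.ext_iff,
    Fin.forall_fin_two] at h40 h31
  simp [h40] at h31

theorem span_basRes : Submodule.span ℂ (Set.range basRes) = ⊤ := by
  rw [eq_top_iff]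
  rintro x -
  obtain ⟨p, rfl⟩ := Ideal.Quotient.mk_surjective x
  induction p using MvPolynomial.induction_on with
  | C c =>
    have h : Ideal.Quotient.mk Ires (C c) = c • basRes 0 := by
      change algebraMap ℂ Hres c = c • (1 : Hres)
      exact Algebra.algebraMap_eq_smul_one c
    rw [h]
    exact Submodule.smul_mem _ _ (Submodule.subset_span ⟨0, rfl⟩)
  | add p q hp hq =>
    rw [map_add]
    exact Submodule.add_mem _ hp hq
  | mul_X p i hp =>
    have h := mul_mem_span_of_relations m2_sq m1_pow_four hp
    rw [map_mul]
    fin_cases i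
    · exact h.1
    · exact h.2

theorem stmt5 :
    LinearIndependent ℂ basRes ∧
    Submodule.span ℂ (Set.range basRes) = ⊤ ∧
    Module.finrank ℂ Hres = 8 ∧
    2 * (m1 ^ 3 * m2) = m1 ^ 4 ∧ m1 ^ 5 = 0 := by
  have hli : LinearIndependent ℂ basRes :=
    linearIndependent_of_pow_four_ne_zero m2_sq m1_pow_four m1_pow_four_ne_zero
  refine ⟨hli, span_basRes, ?_, m1_pow_four.symm, pow_five_eq_zero m2_sq m1_pow_four⟩
  simpa using Module.finrank_eq_card_basis (Module.Basis.mk hli span_basRes.ge)
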